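/- In case 7), let g = diag(-r+ς, r+ς, r-ς, r+ς) (where r = (t+t⁻¹)/2, ς = (t-t⁻¹)/2) and let R be defined as above (for either value of s ∈ {1,-1}; R does not depend on s). For a,b ∈ ℂ, the deformed Clifford relations γ^i γ^j + Σ_{k,l=0}^{3} R^{ji}_{lk} γ^k γ^l = 2 g^{ji}·1₄ hold for all i,j ∈ {0,1,2,3} if and only if ab = 1. -/

import Mathlib

open Matrix Complex Kronecker

noncomputable section

/-- The Pauli matrices σ₀, σ₁, σ₂, σ₃ (indices A,B ∈ {1,2} become 0,1). -/
def pauli : Fin 4 → Matrix (Fin 2) (Fin 2) ℂ :=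
  ![!![1, 0; 0, 1], !![0, 1; 1, 0], !![0, -I; I, 0], !![1, 0; 0, -1]]

/-- The matrix V, V^{AB}_i = (σ_i)_{AB}. -/
def Vmat : Matrix (Fin 2 × Fin 2) (Fin 4) ℂ :=
  Matrix.of fun p i => pauli i p.1 p.2

/-- The matrix V⁻¹, (V⁻¹)^i_{AB} = ½ (σ_i)_{BA}. -/
def Vinv : Matrix (Fin 4) (Fin 2 × Fin 2) ℂ :=
  Matrix.of fun i p => (1 / 2 : ℂ) * pauli i p.2 p.1

/-- Identification of the ordered basis e₁⊗e₁, e₁⊗e₂, e₂⊗e₁, e₂⊗e₂ of ℂ²⊗ℂ²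
with the indices 0,1,2,3. -/
def pidx (p : Fin 2 × Fin 2) : Fin 4 :=
  ⟨2 * p.1.val + p.2.val, by have := p.1.isLt; have := p.2.isLt; omega⟩

/-- Reading a 4×4 matrix as a matrix on ℂ²⊗ℂ² (w.r.t. the basis order above). -/
def toPair (Q : Matrix (Fin 4) (Fin 4) ℂ) : Matrix (Fin 2 × Fin 2) (Fin 2 × Fin 2) ℂ :=
  Matrix.of fun p p' => Q (pidx p) (pidx p')

/-- The flip τ(u⊗v) = v⊗u on ℂ²⊗ℂ² as a 4×4 matrix. -/
def flipM : Matrix (Fin 2 × Fin 2) (Fin 2 × Fin 2) ℂ :=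
  Matrix.of fun p p' => if p.1 = p'.2 ∧ p.2 = p'.1 then 1 else 0

/-- L = s q^{1/2} (1₄ + q E E'), where `Ev` is the column vector E and `Ep` the row covector E'. -/
def Lmat (s sqrtq q : ℂ) (Ev Ep : Fin 2 × Fin 2 → ℂ) :
    Matrix (Fin 2 × Fin 2) (Fin 2 × Fin 2) ℂ :=
  Matrix.of fun p p' => s * sqrtq * ((if p = p' then 1 else 0) + q * Ev p * Ep p')

/-- 1₂⊗Y⊗1₂, acting on the middle two tensor factors of ℂ²⊗ℂ²⊗ℂ²⊗ℂ². -/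
def midX (Y : Matrix (Fin 2 × Fin 2) (Fin 2 × Fin 2) ℂ) :
    Matrix ((Fin 2 × Fin 2) × (Fin 2 × Fin 2)) ((Fin 2 × Fin 2) × (Fin 2 × Fin 2)) ℂ :=
  Matrix.of fun p p' =>
    (if p.1.1 = p'.1.1 then 1 else 0) * Y (p.1.2, p.2.1) (p'.1.2, p'.2.1) *
      (if p.2.2 = p'.2.2 then 1 else 0)

/-- R = (V⁻¹⊗V⁻¹)(1₂⊗X⊗1₂)(L⊗L̃)(1₂⊗X⁻¹⊗1₂)(V⊗V), with L̃ = q τ L τ. -/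
def Rmat (s sqrtq q : ℂ) (Ev Ep : Fin 2 × Fin 2 → ℂ)
    (X : Matrix (Fin 2 × Fin 2) (Fin 2 × Fin 2) ℂ) :
    Matrix (Fin 4 × Fin 4) (Fin 4 × Fin 4) ℂ :=
  (Vinv ⊗ₖ Vinv) * midX X *
    (Lmat s sqrtq q Ev Ep ⊗ₖ (q • (flipM * Lmat s sqrtq q Ev Ep * flipM))) *
    midX X⁻¹ * (Vmat ⊗ₖ Vmat)

/-- A_i = q^{-1/2} Eᵀ (σ_i∘D) E, where D = τX⁻¹τ, (σ_i∘D)_{KL} = Σ_{A,B}(σ_i)_{AB} D^{AB}_{KL},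
and `invsqrtq` denotes q^{-1/2}. -/
def Amat (invsqrtq : ℂ) (E : Matrix (Fin 2) (Fin 2) ℂ)
    (X : Matrix (Fin 2 × Fin 2) (Fin 2 × Fin 2) ℂ) (i : Fin 4) : Matrix (Fin 2) (Fin 2) ℂ :=
  invsqrtq • (E.transpose *
    (Matrix.of fun K L => ∑ A : Fin 2, ∑ B : Fin 2,
      pauli i A B * (flipM * X⁻¹ * flipM) (A, B) (K, L)) * E)

/-- The gamma matrices γ^i = [[0, b A_i],[a σ_i, 0]] as block matrices on ℂ² ⊕ ℂ². -/
def gam (a b invsqrtq : ℂ) (E : Matrix (Fin 2) (Fin 2) ℂ)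
    (X : Matrix (Fin 2 × Fin 2) (Fin 2 × Fin 2) ℂ) (i : Fin 4) :
    Matrix (Fin 2 ⊕ Fin 2) (Fin 2 ⊕ Fin 2) ℂ :=
  Matrix.fromBlocks 0 (b • Amat invsqrtq E X i) (a • pauli i) 0

/-- The matrix `X = τQ'` of the deformation, as a function of `r` and `c`. -/
def deformX (r c : ℂ) : Matrix (Fin 2 × Fin 2) (Fin 2 × Fin 2) ℂ :=
  flipM * toPair (I • !![r, 0, 0, c; 0, -r, c, 0; 0, c, -r, 0; c, 0, 0, r])

/-- The inverse of `deformX r c` when `r ^ 2 - c ^ 2 = 1`. -/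
def deformXInv (r c : ℂ) : Matrix (Fin 2 × Fin 2) (Fin 2 × Fin 2) ℂ :=
  toPair ((-I) • !![r, 0, 0, -c; 0, -c, -r, 0; 0, -r, -c, 0; -c, 0, 0, r])

/-- The exchange matrix `1 - E E'` for the symmetric form `E`. -/
def exchangeM : Matrix (Fin 2 × Fin 2) (Fin 2 × Fin 2) ℂ :=
  toPair !![1, 0, 0, 0; 0, 0, -1, 0; 0, -1, 0, 0; 0, 0, 0, 1]

/-- The diagonal entries of the deformed metric. -/
def metricDiag (r c : ℂ) : Fin 4 → ℂ := ![-r + c, r + c, r - c, r + c]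

/-- The rows of the deformed flip in the vector basis, each written as a 4×4 matrix. -/
def vectorFlip (u v : ℂ) : Fin 4 → Fin 4 → Matrix (Fin 4) (Fin 4) ℂ :=
  ![![Matrix.single 0 0 1, Matrix.single 1 0 u + Matrix.single 3 2 v,
      Matrix.single 2 0 1, Matrix.single 3 0 u - Matrix.single 1 2 v],
    ![Matrix.single 0 1 u - Matrix.single 2 3 v, Matrix.single 1 1 1,
      Matrix.single 2 1 u - Matrix.single 0 3 v, Matrix.single 3 1 1],
    ![Matrix.single 0 2 1, Matrix.single 1 2 u + Matrix.single 3 0 v,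
      Matrix.single 2 2 1, Matrix.single 3 2 u - Matrix.single 1 0 v],
    ![Matrix.single 0 3 u + Matrix.single 2 1 v, Matrix.single 1 3 1,
      Matrix.single 2 3 u + Matrix.single 0 1 v, Matrix.single 3 3 1]]

/-- The deformed flip as a matrix on pairs of indices. -/
def vectorFlipMat (u v : ℂ) : Matrix (Fin 4 × Fin 4) (Fin 4 × Fin 4) ℂ :=
  Matrix.of fun p p' => vectorFlip u v p.1 p.2 p'.1 p'.2

lemma deformX_mul_deformXInv {r c : ℂ} (h : r ^ 2 - c ^ 2 = 1) :
    deformX r c * deformXInv r c = 1 := by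
  ext ⟨i, j⟩ ⟨k, l⟩
  fin_cases i <;> fin_cases j <;> fin_cases k <;> fin_cases l <;>
    simp [deformX, deformXInv, flipM, toPair, pidx, Matrix.mul_apply, Fintype.sum_prod_type] <;>
    grind [I_sq]

lemma inv_deformX {r c : ℂ} (h : r ^ 2 - c ^ 2 = 1) : (deformX r c)⁻¹ = deformXInv r c :=
  Matrix.inv_eq_right_inv (deformX_mul_deformXInv h)

lemma midX_mul (Y Z : Matrix (Fin 2 × Fin 2) (Fin 2 × Fin 2) ℂ) :
    midX (Y * Z) = midX Y * midX Z := by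
  ext ⟨⟨i, j⟩, ⟨k, l⟩⟩ ⟨⟨i', j'⟩, ⟨k', l'⟩⟩
  simp [midX, Matrix.mul_apply, Fintype.sum_prod_type]

lemma midX_one : midX 1 = 1 := by
  ext ⟨⟨i, j⟩, ⟨k, l⟩⟩ ⟨⟨i', j'⟩, ⟨k', l'⟩⟩
  simp only [midX, Matrix.of_apply, Matrix.one_apply, Prod.mk.injEq]
  split_ifs <;> simp_all

lemma Vinv_mul_Vmat : Vinv * Vmat = 1 := by
  ext i j
  fin_cases i <;> fin_cases j <;>
    simp [Vinv, Vmat, pauli, Matrix.mul_apply, Fintype.sum_prod_type] <;> grind [I_sq]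

lemma Lmat_eq (s : ℂ) :
    Lmat s I (-1) (fun p => !![0, 1; 1, 0] p.1 p.2) (fun p => !![0, 1; 1, 0] p.1 p.2) =
      (s * I) • exchangeM := by
  ext ⟨i, j⟩ ⟨k, l⟩
  fin_cases i <;> fin_cases j <;> fin_cases k <;> fin_cases l <;>
    simp [Lmat, exchangeM, toPair, pidx]

lemma flipM_conj_exchangeM : flipM * exchangeM * flipM = exchangeM := by
  ext ⟨i, j⟩ ⟨k, l⟩
  fin_cases i <;> fin_cases j <;> fin_cases k <;> fin_cases l <;>
    simp [flipM, exchangeM, toPair, pidx, Matrix.mul_apply, Fintype.sum_prod_type]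

lemma sum_single_smul {M : Type*} [AddCommGroup M] [Module ℂ M] (l₀ k₀ : Fin 4) (x : ℂ)
    (F : Fin 4 → Fin 4 → M) :
    ∑ k : Fin 4, ∑ l : Fin 4, Matrix.single l₀ k₀ x l k • F k l = x • F k₀ l₀ := by
  simp [Matrix.single_apply, ite_and, ite_smul]

lemma vectorFlipMat_mul_apply {ι : Type*} (u v : ℂ) (Z : Matrix (Fin 4 × Fin 4) ι ℂ)
    (j i : Fin 4) (p : ι) :
    (vectorFlipMat u v * Z) (j, i) p =
      ∑ k : Fin 4, ∑ l : Fin 4, vectorFlip u v j i l k • Z (l, k) p := by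
  rw [Finset.sum_comm]
  simp only [Matrix.mul_apply, Fintype.sum_prod_type, vectorFlipMat, Matrix.of_apply, smul_eq_mul]

lemma mul_exchangeM_kronecker (Z : Matrix (Fin 4 × Fin 4) ((Fin 2 × Fin 2) × (Fin 2 × Fin 2)) ℂ)
    (p : Fin 4 × Fin 4) (A B C D : Fin 2) :
    (Z * (exchangeM ⊗ₖ exchangeM)) p ((A, B), (C, D)) =
      (if A = B then 1 else -1) * (if C = D then 1 else -1) * Z p ((B, A), (D, C)) := by
  fin_cases A <;> fin_cases B <;> fin_cases C <;> fin_cases D <;>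
    simp [exchangeM, toPair, pidx, Matrix.mul_apply, Fintype.sum_prod_type]

lemma Vinv_mul_midX_apply (Y : Matrix (Fin 2 × Fin 2) (Fin 2 × Fin 2) ℂ)
    (A B C D : Fin 2) (j i : Fin 4) :
    ((Vinv ⊗ₖ Vinv) * midX Y) (j, i) ((A, B), (C, D)) =
      ∑ B' : Fin 2, ∑ C' : Fin 2,
        1 / 4 * (pauli j B' A * pauli i D C' * Y (B', C') (B, C)) := by
  simp only [midX, Vinv, Matrix.mul_apply, Fintype.sum_prod_type, Matrix.kronecker_apply,
    Matrix.of_apply]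
  fin_cases A <;> fin_cases D <;> simp <;> ring

lemma Vinv_mul_deformX_apply (r c : ℂ) (A B C D : Fin 2) (j i : Fin 4) :
    ((Vinv ⊗ₖ Vinv) * midX (deformX r c)) (j, i) ((A, B), (C, D)) =
      I / 4 * if B = C then
          r * (pauli j B A * pauli i D B) + c * (pauli j (B + 1) A * pauli i D (B + 1))
        else c * (pauli j B A * pauli i D C) - r * (pauli j C A * pauli i D B) := by
  rw [Vinv_mul_midX_apply]
  fin_cases B <;> fin_cases C <;>
    simp [deformX, flipM, Matrix.mul_apply, Fintype.sum_prod_type, toPair, pidx] <;> ring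

set_option maxHeartbeats 4000000 in
/-- In the spinor basis the deformed flip of vectors exchanges the spinor indices. -/
lemma exchange_intertwines {r c : ℂ} (h : r ^ 2 - c ^ 2 = 1) :
    (Vinv ⊗ₖ Vinv) * midX (deformX r c) * (exchangeM ⊗ₖ exchangeM) =
      vectorFlipMat (r ^ 2 + c ^ 2) (2 * I * r * c) *
        ((Vinv ⊗ₖ Vinv) * midX (deformX r c)) := by
  ext ⟨j, i⟩ ⟨⟨A, B⟩, ⟨C, D⟩⟩
  rw [mul_exchangeM_kronecker, vectorFlipMat_mul_apply]
  simp only [Vinv_mul_deformX_apply]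
  fin_cases j <;> fin_cases i <;>
    simp only [vectorFlip, Matrix.cons_val, Fin.zero_eta, Fin.mk_one, Fin.reduceFinMk,
      Matrix.add_apply, Matrix.sub_apply, add_smul, sub_smul, Finset.sum_add_distrib,
      Finset.sum_sub_distrib, sum_single_smul, one_smul] <;>
    fin_cases A <;> fin_cases B <;> fin_cases C <;> fin_cases D <;>
    simp [pauli] <;> grind [I_sq]

lemma Rmat_deformX {r c s : ℂ} (h : r ^ 2 - c ^ 2 = 1) (hs : s = 1 ∨ s = -1) :
    Rmat s I (-1) (fun p => !![0, 1; 1, 0] p.1 p.2) (fun p => !![0, 1; 1, 0] p.1 p.2)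
      (deformX r c) = vectorFlipMat (r ^ 2 + c ^ 2) (2 * I * r * c) := by
  have hL : ((s * I) • exchangeM) ⊗ₖ ((-1 : ℂ) • (flipM * ((s * I) • exchangeM) * flipM)) =
      exchangeM ⊗ₖ exchangeM := by
    have hs2 : s * I * (s * I) = -1 := by
      rcases hs with rfl | rfl <;> simp
    rw [Matrix.mul_smul, Matrix.smul_mul, flipM_conj_exchangeM, Matrix.kronecker_smul,
      Matrix.kronecker_smul, Matrix.smul_kronecker, smul_smul, smul_smul, mul_assoc, hs2]
    simp
  rw [Rmat, Lmat_eq, hL, inv_deformX h]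
  simp only [Matrix.mul_assoc]
  rw [← Matrix.mul_assoc (midX _), ← Matrix.mul_assoc (Vinv ⊗ₖ Vinv),
    ← Matrix.mul_assoc (Vinv ⊗ₖ Vinv), exchange_intertwines h]
  simp only [Matrix.mul_assoc]
  rw [← Matrix.mul_assoc (midX _) (midX _), ← midX_mul, deformX_mul_deformXInv h, midX_one,
    Matrix.one_mul, ← Matrix.mul_kronecker_mul, Vinv_mul_Vmat, Matrix.one_kronecker_one,
    Matrix.mul_one]

lemma Amat_deformX {r c : ℂ} (h : r ^ 2 - c ^ 2 = 1) (i : Fin 4) :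
    Amat I⁻¹ !![0, 1; 1, 0] (deformX r c) i = metricDiag r c i • pauli i := by
  have hD : ∀ A B K L : Fin 2,
      (flipM * deformXInv r c * flipM) (A, B) (K, L) = deformXInv r c (B, A) (L, K) := by
    intro A B K L
    fin_cases A <;> fin_cases B <;> fin_cases K <;> fin_cases L <;>
      simp [flipM, Matrix.mul_apply, Fintype.sum_prod_type]
  rw [Amat, inv_deformX h]
  simp only [hD]
  ext K L
  fin_cases i <;> fin_cases K <;> fin_cases L <;>
    simp [deformXInv, toPair, pidx, metricDiag, pauli, Matrix.mul_apply, Fin.sum_univ_two] <;>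
    grind [I_sq]

set_option maxHeartbeats 1000000 in
/-- The deformed Clifford relations for the Pauli matrices, with the metric coefficient attached
to the left or to the right factor. -/
lemma pauli_relations {r c : ℂ} (h : r ^ 2 - c ^ 2 = 1) (i j : Fin 4) :
    metricDiag r c i • (pauli i * pauli j) +
        ∑ k : Fin 4, ∑ l : Fin 4, vectorFlip (r ^ 2 + c ^ 2) (2 * I * r * c) j i l k •
          (metricDiag r c k • (pauli k * pauli l)) =
        (2 * diagonal (metricDiag r c) j i) • 1 ∧
      metricDiag r c j • (pauli i * pauli j) +
        ∑ k : Fin 4, ∑ l : Fin 4, vectorFlip (r ^ 2 + c ^ 2) (2 * I * r * c) j i l k •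
          (metricDiag r c l • (pauli k * pauli l)) =
        (2 * diagonal (metricDiag r c) j i) • 1 := by
  fin_cases i <;> fin_cases j <;>
    simp only [vectorFlip, Matrix.cons_val, Fin.zero_eta, Fin.mk_one, Fin.reduceFinMk,
      Matrix.add_apply, Matrix.sub_apply, add_smul, sub_smul, Finset.sum_add_distrib,
      Finset.sum_sub_distrib, sum_single_smul] <;>
    refine ⟨?_, ?_⟩ <;> ext K L <;> fin_cases K <;> fin_cases L <;>
    simp [metricDiag, pauli] <;> grind [I_sq]

lemma gam_mul_gam {r c : ℂ} (h : r ^ 2 - c ^ 2 = 1) (a b : ℂ) (i j : Fin 4) :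
    gam a b I⁻¹ !![0, 1; 1, 0] (deformX r c) i * gam a b I⁻¹ !![0, 1; 1, 0] (deformX r c) j =
      (a * b) • fromBlocks (metricDiag r c i • (pauli i * pauli j)) 0 0
        (metricDiag r c j • (pauli i * pauli j)) := by
  simp only [gam, Amat_deformX h, Matrix.fromBlocks_multiply, Matrix.fromBlocks_smul,
    Matrix.zero_mul, Matrix.mul_zero, zero_add, add_zero, smul_zero, Matrix.smul_mul,
    Matrix.mul_smul, smul_smul]
  congr 2 <;> ring

lemma gam_relation {r c s : ℂ} (h : r ^ 2 - c ^ 2 = 1) (hs : s = 1 ∨ s = -1) (a b : ℂ)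
    (i j : Fin 4) :
    gam a b I⁻¹ !![0, 1; 1, 0] (deformX r c) i * gam a b I⁻¹ !![0, 1; 1, 0] (deformX r c) j +
      ∑ k : Fin 4, ∑ l : Fin 4,
        Rmat s I (-1) (fun p => !![0, 1; 1, 0] p.1 p.2) (fun p => !![0, 1; 1, 0] p.1 p.2)
          (deformX r c) (j, i) (l, k) •
        (gam a b I⁻¹ !![0, 1; 1, 0] (deformX r c) k *
          gam a b I⁻¹ !![0, 1; 1, 0] (deformX r c) l) =
      (a * b * (2 * diagonal (metricDiag r c) j i)) • 1 := by
  simp only [Rmat_deformX h hs, gam_mul_gam h]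
  obtain ⟨h₁, h₂⟩ := pauli_relations h i j
  have hF : fromBlocks ((2 * diagonal (metricDiag r c) j i) • (1 : Matrix (Fin 2) (Fin 2) ℂ)) 0 0
      ((2 * diagonal (metricDiag r c) j i) • (1 : Matrix (Fin 2) (Fin 2) ℂ)) =
      (2 * diagonal (metricDiag r c) j i) • 1 := by
    rw [← Matrix.fromBlocks_one, Matrix.fromBlocks_smul, smul_zero]
  rw [mul_smul (a * b), ← hF]
  nth_rewrite 1 [← h₁]
  rw [← h₂]
  ext (x | x) (y | y) <;>
    simp [vectorFlipMat, Matrix.sum_apply, mul_add, Finset.mul_sum, mul_left_comm]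

/-- in case 7), for either s ∈ {1,-1}, the deformed Clifford relations
γ^i γ^j + Σ_{k,l} R^{ji}_{lk} γ^k γ^l = 2 g^{ji} 1₄ hold for all i,j iff ab = 1;
here r = (t+t⁻¹)/2, ς = (t-t⁻¹)/2, q = -1, q^{1/2} = i. -/
theorem clifford_case7 (t : ℝ) (ht0 : 0 < t) (ht1 : t < 1) (r ς : ℂ)
    (hr : r = ((t : ℂ) + (t : ℂ)⁻¹) / 2) (hς : ς = ((t : ℂ) - (t : ℂ)⁻¹) / 2)
    (s : ℂ) (hs : s = 1 ∨ s = -1) (a b : ℂ) :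
    (∀ i j : Fin 4,
        gam a b I⁻¹ !![0, 1; 1, 0]
            (flipM * toPair (I • !![r, 0, 0, ς; 0, -r, ς, 0; 0, ς, -r, 0; ς, 0, 0, r])) i *
          gam a b I⁻¹ !![0, 1; 1, 0]
            (flipM * toPair (I • !![r, 0, 0, ς; 0, -r, ς, 0; 0, ς, -r, 0; ς, 0, 0, r])) j +
        ∑ k : Fin 4, ∑ l : Fin 4,
          Rmat s I (-1) (fun p => !![0, 1; 1, 0] p.1 p.2) (fun p => !![0, 1; 1, 0] p.1 p.2)
              (flipM * toPair (I • !![r, 0, 0, ς; 0, -r, ς, 0; 0, ς, -r, 0; ς, 0, 0, r]))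
              (j, i) (l, k) •
            (gam a b I⁻¹ !![0, 1; 1, 0]
                (flipM * toPair (I • !![r, 0, 0, ς; 0, -r, ς, 0; 0, ς, -r, 0; ς, 0, 0, r])) k *
              gam a b I⁻¹ !![0, 1; 1, 0]
                (flipM * toPair (I • !![r, 0, 0, ς; 0, -r, ς, 0; 0, ς, -r, 0; ς, 0, 0, r])) l)
        = (2 * Matrix.diagonal ![-r + ς, r + ς, r - ς, r + ς] j i) •
            (1 : Matrix (Fin 2 ⊕ Fin 2) (Fin 2 ⊕ Fin 2) ℂ))
      ↔ a * b = 1 := by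
  have h : r ^ 2 - ς ^ 2 = 1 := by
    have ht : (t : ℂ) ≠ 0 := by exact_mod_cast ht0.ne'
    rw [hr, hς]
    field_simp
    ring
  have hg : metricDiag r ς 0 ≠ 0 := by
    intro h0
    have h1 : -r + ς = 0 := h0
    exact one_ne_zero (h ▸ show r ^ 2 - ς ^ 2 = 0 by linear_combination (-(r + ς)) * h1)
  have key := gam_relation h hs a b
  simp only [deformX] at key
  constructor
  · intro H
    have h00 := (key 0 0).symm.trans (H 0 0)
    have := congrFun (congrFun h00 (Sum.inl 0)) (Sum.inl 0)
    simp only [Matrix.smul_apply, Matrix.diagonal_apply_eq, Matrix.one_apply_eq, smul_eq_mul,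
      mul_one] at this
    change a * b * (2 * metricDiag r ς 0) = 2 * metricDiag r ς 0 at this
    exact mul_right_cancel₀ (mul_ne_zero two_ne_zero hg) (this.trans (one_mul _).symm)
  · intro hab i j
    rw [key i j, hab, one_mul]
    rfl
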